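/- Let (X, μ) be a finite measure space and M ≥ 0. Let (A_k) and (B_k) be sequences of real-valued measurable functions on X such that: |A_k| ≤ M μ-a.e. for all k; A_k → 0 μ-a.e. as k → ∞; each B_k is integrable; and there exists an integrable function B such that ∫_X B_k z dμ → ∫_X B z dμ for every z ∈ L^∞(μ) (i.e. B_k → B weakly in L¹(μ)). Then ∫_X A_k B_k dμ → 0 as k → ∞. -/

import Mathlib

open MeasureTheory Filter

/-- Classes in `L¹(μ)` that are bounded by `1` almost everywhere. -/
def l1BoundedByOne {X : Type*} [MeasurableSpace X] (μ : Measure X) : Set (Lp ℝ 1 μ) :=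
  {z | ∀ᵐ x ∂μ, |z x| ≤ 1}

lemma exists_subseq_ae_tendsto_of_tendsto_Lp_one {X : Type*} [MeasurableSpace X] {μ : Measure X}
    {f : ℕ → Lp ℝ 1 μ} {g : Lp ℝ 1 μ} (h : Tendsto f atTop (nhds g)) :
    ∃ ms : ℕ → ℕ, StrictMono ms ∧ ∀ᵐ x ∂μ, Tendsto (fun n => f (ms n) x) atTop (nhds (g x)) :=
  (tendstoInMeasure_of_tendsto_Lp h).exists_seq_tendsto_ae

lemma isClosed_l1BoundedByOne {X : Type*} [MeasurableSpace X] (μ : Measure X) :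
    IsClosed (l1BoundedByOne μ) := by
  refine IsSeqClosed.isClosed fun f g hf hfg => ?_
  obtain ⟨ms, -, hms⟩ := exists_subseq_ae_tendsto_of_tendsto_Lp_one hfg
  filter_upwards [hms, ae_all_iff.2 hf] with x hx hfx
  exact le_of_tendsto' hx.abs fun n => hfx (ms n)

lemma abs_mul_le_abs_of_abs_le_one {a b : ℝ} (hb : |b| ≤ 1) : |a * b| ≤ |a| := by
  rw [abs_mul]
  exact mul_le_of_le_one_right (abs_nonneg a) hb

lemma integrable_mul_of_abs_le_one {X : Type*} [MeasurableSpace X] {μ : Measure X} {c z : X → ℝ}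
    (hc : Integrable c μ) (hz : AEStronglyMeasurable z μ) (hz1 : ∀ᵐ x ∂μ, |z x| ≤ 1) :
    Integrable (fun x => c x * z x) μ :=
  hc.mono (hc.aestronglyMeasurable.mul hz) <| hz1.mono fun _ hx => abs_mul_le_abs_of_abs_le_one hx

lemma continuous_integral_mul_l1BoundedByOne {X : Type*} [MeasurableSpace X] {μ : Measure X}
    {c : X → ℝ} (hc : Integrable c μ) :
    Continuous fun z : l1BoundedByOne μ => ∫ x, c x * z.1 x ∂μ := by
  refine continuous_iff_seqContinuous.2 fun f g hfg => ?_
  refine tendsto_of_subseq_tendsto fun ns hns => ?_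
  obtain ⟨ms, -, hms⟩ := exists_subseq_ae_tendsto_of_tendsto_Lp_one
    ((continuous_subtype_val.tendsto g).comp (hfg.comp hns))
  refine ⟨ms, tendsto_integral_of_dominated_convergence (fun x => |c x|)
    (fun n => hc.aestronglyMeasurable.mul (Lp.aestronglyMeasurable _)) hc.abs (fun n => ?_) ?_⟩
  · have h : ∀ᵐ x ∂μ, |(f (ns (ms n))).1 x| ≤ 1 := (f (ns (ms n))).2
    exact h.mono fun x hx => abs_mul_le_abs_of_abs_le_one hx
  · exact hms.mono fun x hx => hx.const_mul (c x)

/-- A sequence of integrable functions converging to `0` weakly in `L¹(μ)` is eventually uniformly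
small on an `L¹`-neighbourhood of some point of the unit ball of `L^∞(μ)`. -/
lemma exists_ball_abs_integral_mul_le {X : Type*} [MeasurableSpace X] {μ : Measure X}
    {c : ℕ → X → ℝ} (hc : ∀ k, Integrable (c k) μ)
    (hweak : ∀ z : X → ℝ, AEStronglyMeasurable z μ → (∀ᵐ x ∂μ, |z x| ≤ 1) →
      Tendsto (fun k => ∫ x, c k x * z x ∂μ) atTop (nhds 0)) {ε : ℝ} (hε : 0 < ε) :
    ∃ N : ℕ, ∃ z₀ ∈ l1BoundedByOne μ, ∃ δ > 0, ∀ z ∈ l1BoundedByOne μ, dist z z₀ < δ →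
      ∀ k ≥ N, |∫ x, c k x * z x ∂μ| ≤ ε := by
  have : CompleteSpace (l1BoundedByOne μ) := (isClosed_l1BoundedByOne μ).completeSpace_coe
  have : Nonempty (l1BoundedByOne μ) := ⟨0, by
    filter_upwards [Lp.coeFn_zero ℝ 1 μ] with x hx
    rw [hx, Pi.zero_apply, abs_zero]
    exact zero_le_one⟩
  let F : ℕ → Set (l1BoundedByOne μ) := fun N => ⋂ k ≥ N, {z | |∫ x, c k x * z.1 x ∂μ| ≤ ε}
  have hF : ∀ N, IsClosed (F N) := fun N => isClosed_biInter fun k _ =>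
    isClosed_le (continuous_integral_mul_l1BoundedByOne (hc k)).abs continuous_const
  have hU : ⋃ N, F N = Set.univ := by
    refine Set.eq_univ_of_forall fun z => Set.mem_iUnion.2 ?_
    have h := (hweak z.1 (Lp.aestronglyMeasurable _) z.2).abs
    rw [abs_zero] at h
    obtain ⟨N, hN⟩ := eventually_atTop.1 (h.eventually_le_const hε)
    exact ⟨N, Set.mem_iInter₂.2 hN⟩
  obtain ⟨N, z₀, hz₀⟩ := nonempty_interior_of_iUnion_of_closed hF hU
  obtain ⟨δ, hδ, hball⟩ := Metric.mem_nhds_iff.1 (mem_interior_iff_mem_nhds.1 hz₀)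
  exact ⟨N, z₀.1, z₀.2, δ, hδ, fun z hz hd k hk =>
    Set.mem_iInter₂.1 (hball (show (⟨z, hz⟩ : l1BoundedByOne μ) ∈ Metric.ball z₀ δ from hd)) k hk⟩

lemma dist_toL1_le_two_mul_integral_abs {X : Type*} [MeasurableSpace X] {μ : Measure X}
    {z₀ : Lp ℝ 1 μ} {u w : X → ℝ} (hu : Integrable u μ) (hw : Integrable w μ)
    (h : ∀ᵐ x ∂μ, |u x - z₀ x| ≤ 2 * |w x|) :
    dist (hu.toL1 u) z₀ ≤ 2 * ∫ x, |w x| ∂μ := by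
  rw [dist_eq_norm, L1.norm_eq_integral_norm, ← integral_const_mul]
  refine integral_mono_ae (L1.integrable_coeFn _).norm (hw.abs.const_mul 2) ?_
  filter_upwards [h, Lp.coeFn_sub (hu.toL1 u) z₀, hu.coeFn_toL1] with x hx h₁ h₂
  simpa only [h₁, Pi.sub_apply, h₂, Real.norm_eq_abs] using hx

lemma tendsto_integral_mul_of_weak_tendsto_zero {X : Type*} [MeasurableSpace X] {μ : Measure X}
    [IsFiniteMeasure μ] {c w : ℕ → X → ℝ} (hc : ∀ k, Integrable (c k) μ)
    (hweak : ∀ z : X → ℝ, AEStronglyMeasurable z μ → (∀ᵐ x ∂μ, |z x| ≤ 1) →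
      Tendsto (fun k => ∫ x, c k x * z x ∂μ) atTop (nhds 0))
    (hw : ∀ k, AEStronglyMeasurable (w k) μ) (hw1 : ∀ k, ∀ᵐ x ∂μ, |w k x| ≤ 1)
    (hw0 : ∀ᵐ x ∂μ, Tendsto (fun k => w k x) atTop (nhds 0)) :
    Tendsto (fun k => ∫ x, c k x * w k x ∂μ) atTop (nhds 0) := by
  have hwint : ∀ k, Integrable (w k) μ := fun k => .of_bound (hw k) 1 (hw1 k)
  have hwnorm : Tendsto (fun k => 2 * ∫ x, |w k x| ∂μ) atTop (nhds 0) := by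
    have h := tendsto_integral_of_dominated_convergence (F := fun k x => |w k x|) (f := fun _ => 0)
      (fun _ => (1 : ℝ)) (fun k => (hwint k).abs.aestronglyMeasurable) (integrable_const _)
      (fun k => (hw1 k).mono fun x hx => by simpa using hx)
      (hw0.mono fun x hx => by simpa using hx.abs)
    simpa using h.const_mul 2
  rw [Metric.tendsto_atTop]
  intro ε hε
  obtain ⟨N, z₀, hz₀, δ, hδ, hball⟩ :=
    exists_ball_abs_integral_mul_le hc hweak (show 0 < ε / 3 by positivity)
  obtain ⟨N', hN'⟩ := eventually_atTop.1 (hwnorm.eventually_lt_const hδ)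
  refine ⟨max N N', fun k hk => ?_⟩
  have hsmall : ∀ u : X → ℝ, AEStronglyMeasurable u μ → (∀ᵐ x ∂μ, |u x| ≤ 1) →
      (∀ᵐ x ∂μ, |u x - z₀ x| ≤ 2 * |w k x|) → |∫ x, c k x * u x ∂μ| ≤ ε / 3 := by
    intro u hu hu1 hd
    have hui : Integrable u μ := .of_bound hu 1 hu1
    have hmem : hui.toL1 u ∈ l1BoundedByOne μ := by
      filter_upwards [hu1, hui.coeFn_toL1] with x hx h
      rwa [h]
    have h := hball _ hmem ((dist_toL1_le_two_mul_integral_abs hui (hwint k) hd).trans_lt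
      (hN' k (le_of_max_le_right hk))) k (le_of_max_le_left hk)
    rwa [integral_congr_ae (g := fun x => c k x * u x)
      (hui.coeFn_toL1.mono fun x hx => by simp only [hx])] at h
  -- `w = u - v`, where `u` and `v` lie in the unit ball and are close to `z₀`.
  let v : X → ℝ := fun x => z₀ x * (1 - |w k x|)
  let u : X → ℝ := fun x => v x + w k x
  have hvm : AEStronglyMeasurable v μ := (Lp.aestronglyMeasurable z₀).mul
    (aestronglyMeasurable_const.sub (hwint k).abs.aestronglyMeasurable)
  have hum : AEStronglyMeasurable u μ := hvm.add (hw k)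
  have hvle : ∀ᵐ x ∂μ, |v x| ≤ 1 - |w k x| := by
    filter_upwards [hz₀, hw1 k] with x hx hwx
    rw [abs_mul, abs_of_nonneg (sub_nonneg.2 hwx)]
    exact mul_le_of_le_one_left (sub_nonneg.2 hwx) hx
  have hv1 : ∀ᵐ x ∂μ, |v x| ≤ 1 := hvle.mono fun x hx => by linarith [abs_nonneg (w k x)]
  have hu1 : ∀ᵐ x ∂μ, |u x| ≤ 1 := hvle.mono fun x hx => by
    linarith [abs_add_le (v x) (w k x)]
  have hvd : ∀ᵐ x ∂μ, |v x - z₀ x| ≤ |w k x| := by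
    filter_upwards [hz₀] with x hx
    rw [show v x - z₀ x = -(|w k x| * z₀ x) by ring, abs_neg]
    exact (abs_mul_le_abs_of_abs_le_one hx).trans_eq (abs_abs _)
  have hud : ∀ᵐ x ∂μ, |u x - z₀ x| ≤ 2 * |w k x| := hvd.mono fun x hx => by
    rw [show u x - z₀ x = (v x - z₀ x) + w k x by ring]
    linarith [abs_add_le (v x - z₀ x) (w k x)]
  have hv := hsmall v hvm hv1 (hvd.mono fun x hx => by linarith [abs_nonneg (w k x)])
  have hu := hsmall u hum hu1 hud
  have hsub : ∫ x, c k x * w k x ∂μ = ∫ x, c k x * u x ∂μ - ∫ x, c k x * v x ∂μ := by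
    rw [← integral_sub (integrable_mul_of_abs_le_one (hc k) hum hu1)
      (integrable_mul_of_abs_le_one (hc k) hvm hv1)]
    exact integral_congr_ae (.of_forall fun x => by simp only [u]; ring)
  rw [dist_zero_right, Real.norm_eq_abs, hsub]
  linarith [abs_sub (∫ x, c k x * u x ∂μ) (∫ x, c k x * v x ∂μ)]

/-- If `|A_k| ≤ M` a.e., `A_k → 0` a.e., and `B_k → B` weakly in `L¹(μ)` on a finite
measure space, then `∫ A_k B_k dμ → 0`. -/
theorem stmt_11 {X : Type*} [MeasurableSpace X] (μ : Measure X) [IsFiniteMeasure μ]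
    (M : ℝ) (hM : 0 ≤ M) (A B : ℕ → X → ℝ) (Blim : X → ℝ)
    (hAmeas : ∀ k, AEStronglyMeasurable (A k) μ)
    (hAbd : ∀ k, ∀ᵐ x ∂μ, |A k x| ≤ M)
    (hAto0 : ∀ᵐ x ∂μ, Tendsto (fun k => A k x) atTop (nhds 0))
    (hBint : ∀ k, Integrable (B k) μ)
    (hBlimint : Integrable Blim μ)
    (hBweak : ∀ z : X → ℝ, AEStronglyMeasurable z μ → (∃ C : ℝ, ∀ᵐ x ∂μ, |z x| ≤ C) →
      Tendsto (fun k => ∫ x, B k x * z x ∂μ) atTop (nhds (∫ x, Blim x * z x ∂μ))) :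
    Tendsto (fun k => ∫ x, A k x * B k x ∂μ) atTop (nhds 0) := by
  have hM1 : 0 < M + 1 := by linarith
  have hw1 : ∀ k, ∀ᵐ x ∂μ, |A k x / (M + 1)| ≤ 1 := fun k => (hAbd k).mono fun x hx => by
    rw [abs_div, abs_of_pos hM1, div_le_one hM1]
    linarith
  have hwm : ∀ k, AEStronglyMeasurable (fun x => A k x / (M + 1)) μ := fun k => by
    simpa only [div_eq_mul_inv] using (hAmeas k).mul_const (M + 1)⁻¹
  have hw0 : ∀ᵐ x ∂μ, Tendsto (fun k => A k x / (M + 1)) atTop (nhds 0) :=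
    hAto0.mono fun x hx => by simpa using hx.div_const (M + 1)
  have hdiff := tendsto_integral_mul_of_weak_tendsto_zero (c := fun k x => B k x - Blim x)
    (fun k => (hBint k).sub hBlimint) (fun z hz hz1 => by
      have h := (hBweak z hz ⟨1, hz1⟩).sub_const (∫ x, Blim x * z x ∂μ)
      rw [sub_self] at h
      refine h.congr fun k => ?_
      rw [← integral_sub (integrable_mul_of_abs_le_one (hBint k) hz hz1)
        (integrable_mul_of_abs_le_one hBlimint hz hz1)]
      simp only [sub_mul]) hwm hw1 hw0
  have hlim : Tendsto (fun k => ∫ x, Blim x * (A k x / (M + 1)) ∂μ) atTop (nhds 0) := by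
    have h := tendsto_integral_of_dominated_convergence
      (F := fun k x => Blim x * (A k x / (M + 1))) (f := fun _ => 0) (fun x => |Blim x|)
      (fun k => hBlimint.aestronglyMeasurable.mul (hwm k)) hBlimint.abs
      (fun k => (hw1 k).mono fun x hx => abs_mul_le_abs_of_abs_le_one hx)
      (hw0.mono fun x hx => by simpa using hx.const_mul (Blim x))
    simpa using h
  have h := (hdiff.add hlim).const_mul (M + 1)
  rw [add_zero, mul_zero] at h
  refine h.congr fun k => ?_
  rw [← integral_add (f := fun x => (B k x - Blim x) * (A k x / (M + 1)))
    (integrable_mul_of_abs_le_one ((hBint k).sub hBlimint) (hwm k) (hw1 k))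
    (integrable_mul_of_abs_le_one hBlimint (hwm k) (hw1 k)), ← integral_const_mul]
  refine integral_congr_ae (.of_forall fun x => ?_)
  field_simp
  ring
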